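/- arXiv:2605.28311 — 3 statements merged into one kernel-verified Lean document; each statement's English description precedes it below -/
import Mathlib

section
/- Let X and Y be Banach spaces. Assume that X fails the Infinite Sprawling Tree Property and that Y bi-Lipschitz embeds into X. Then Y fails the Infinite Sprawling Tree Property. -/
open Metric Set Topology

noncomputable section

/-- Transfinite iteration of a derivation `d` starting from `a`;
meets are taken at limit stages. -/
def derivIter {L : Type*} [CompleteLattice L] (d : L → L) (a : L) (α : Ordinal) : L :=
  Ordinal.limitRecOn α a (fun _ ih => d ih) (fun o _ ih => ⨅ (γ : Ordinal) (h : γ < o), ih γ h)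

/-- The weak topology of a real normed space. -/
def weakTop (X : Type*) [NormedAddCommGroup X] [NormedSpace ℝ X] : TopologicalSpace X :=
  TopologicalSpace.induced (fun (x : X) (f : X →L[ℝ] ℝ) => f x) inferInstance

variable {X : Type*} [NormedAddCommGroup X] [NormedSpace ℝ X]

/-- The dentability derivation `d_ε^1`. -/
def dentDeriv (ε : ℝ) (C : Set X) : Set X :=
  C \ ⋃ (f : X →L[ℝ] ℝ) (a : ℝ) (_ : Metric.diam ({y | a < f y} ∩ C) < ε), {y | a < f y}

/-- The weak fragmentation derivation `σ_ε^1`. -/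
def weakDeriv (ε : ℝ) (C : Set X) : Set X :=
  C \ ⋃ (V : Set X) (_ : IsOpen[weakTop X] V) (_ : Metric.diam (V ∩ C) < ε), V

/-- The convex weak fragmentation derivation `γ_ε^1`. -/
def convDeriv (ε : ℝ) (C : Set X) : Set X :=
  closure (convexHull ℝ (weakDeriv ε C))

/-- `treeRoot C δ α x` : `x` is the root of a `δ`-`α`-tree contained in `C`. -/
def treeRoot (C : Set X) (δ : ℝ) (α : Ordinal) : X → Prop :=
  Ordinal.limitRecOn α (fun x => x ∈ C)
    (fun _ ih x => x ∈ C ∧ ∃ y z : X,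
      x = (2⁻¹ : ℝ) • (y + z) ∧ δ ≤ 2⁻¹ * ‖y - z‖ ∧ ih y ∧ ih z)
    (fun o _ ih x => ∀ γ (h : γ < o), ih γ h x)

/-- `sprawlRoot C δ α x` : `x` is the root of a `δ`-`α`-sprawling tree contained in `C`. -/
def sprawlRoot (C : Set X) (δ : ℝ) (α : Ordinal) : X → Prop :=
  Ordinal.limitRecOn α (fun x => x ∈ C)
    (fun _ ih x => x ∈ C ∧ ∃ y z : ℕ → X,
      (∀ n, x = (2⁻¹ : ℝ) • (y n + z n)) ∧
      (∀ n m, n ≠ m → δ ≤ ‖y n - y m‖) ∧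
      (∀ n, ih (y n)) ∧ (∀ n, ih (z n)))
    (fun o _ ih x => ∀ γ (h : γ < o), ih γ h x)

/-- `bushRoot C δ α x` : `x` is the root of a `δ`-`α`-bush contained in `C`. -/
def bushRoot (C : Set X) (δ : ℝ) (α : Ordinal) : X → Prop :=
  Ordinal.limitRecOn α (fun x => x ∈ C)
    (fun _ ih x => x ∈ C ∧ ∃ (n : ℕ) (y : Fin (n + 1) → X) (lam : Fin (n + 1) → ℝ),
      (∀ i, 0 < lam i ∧ lam i ≤ 1) ∧ (∑ i, lam i = 1) ∧
      x = ∑ i, lam i • y i ∧ (∀ i, δ ≤ ‖x - y i‖) ∧ ∀ i, ih (y i))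
    (fun o _ ih x => ∀ γ (h : γ < o), ih γ h x)

/-- `X` has the Slice Point of Continuity Property. -/
def SlicePCP (X : Type*) [NormedAddCommGroup X] [NormedSpace ℝ X] : Prop :=
  ∀ A : Set X, A.Nonempty → Bornology.IsBounded A → ∀ ε > (0 : ℝ),
    ∃ (f : X →L[ℝ] ℝ) (a : ℝ), ({y | a < f y} ∩ A).Nonempty ∧
      ∀ x ∈ {y | a < f y} ∩ A, ∃ V ∈ @nhds X (weakTop X) x, Metric.diam (V ∩ A) < ε

/-- `f : Y → X` is a bi-Lipschitz embedding. -/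
def IsBiLipEmb {Y X : Type*} [NormedAddCommGroup Y] [NormedAddCommGroup X] (f : Y → X) : Prop :=
  ∃ A B : ℝ, 0 < A ∧ A ≤ B ∧
    ∀ u v : Y, A * ‖u - v‖ ≤ ‖f u - f v‖ ∧ ‖f u - f v‖ ≤ B * ‖u - v‖

/-- `X` has the Infinite Sprawling Tree Property: for some `δ > 0` there is a family in `B_X`
indexed by all finite sequences in `{0,1} × ω` with `x_s = ½(x_{s⌢(0,n)} + x_{s⌢(1,n)})` for
every `n` and `‖x_{s⌢(0,n)} - x_{s⌢(0,m)}‖ ≥ δ` for `n ≠ m`. -/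
def InfiniteSprawlingTreeProperty (X : Type*) [NormedAddCommGroup X] [NormedSpace ℝ X] : Prop :=
  ∃ δ > (0 : ℝ), ∃ x : List (Bool × ℕ) → X, (∀ s, ‖x s‖ ≤ 1) ∧
    ∀ s : List (Bool × ℕ),
      (∀ n : ℕ, x s = (2⁻¹ : ℝ) • (x (s ++ [(false, n)]) + x (s ++ [(true, n)]))) ∧
      (∀ n m : ℕ, n ≠ m → δ ≤ ‖x (s ++ [(false, n)]) - x (s ++ [(false, m)])‖)

/-- The starting point of the segment with increment `2 ^ (-k) • x t`, `k = t.length`, on the path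
from `0` to `x []` obtained by replacing successively each increment `2 ^ (-k) • x s` by
`2 ^ (-k - 1) • x (s ++ [(false, n)])` followed by `2 ^ (-k - 1) • x (s ++ [(true, n)])`.
The argument is the reversal of `t`. -/
def segmentStart {Y : Type*} [NormedAddCommGroup Y] [NormedSpace ℝ Y]
    (x : List (Bool × ℕ) → Y) : List (Bool × ℕ) → Y
  | [] => 0
  | (false, _) :: r => segmentStart x r
  | (true, n) :: r =>
      segmentStart x r + ((2 : ℝ) ^ (r.length + 1))⁻¹ • x (r.reverse ++ [(false, n)])

/-- The difference quotient of `f` along the segment of the path indexed by `s`. -/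
def segmentQuotient {X Y : Type*} [NormedAddCommGroup X] [NormedSpace ℝ X]
    [NormedAddCommGroup Y] [NormedSpace ℝ Y] (f : Y → X) (x : List (Bool × ℕ) → Y)
    (s : List (Bool × ℕ)) : X :=
  (2 : ℝ) ^ s.length •
    (f (segmentStart x s.reverse + ((2 : ℝ) ^ s.length)⁻¹ • x s) - f (segmentStart x s.reverse))

section segmentQuotient

variable {X Y : Type*} [NormedAddCommGroup X] [NormedSpace ℝ X]
  [NormedAddCommGroup Y] [NormedSpace ℝ Y] (f : Y → X) (x : List (Bool × ℕ) → Y)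

theorem norm_segmentQuotient_le {B : ℝ} (hB : 0 ≤ B) (hf : ∀ u v, ‖f u - f v‖ ≤ B * ‖u - v‖)
    (hx : ∀ s, ‖x s‖ ≤ 1) (s : List (Bool × ℕ)) : ‖segmentQuotient f x s‖ ≤ B := by
  have hc : (0 : ℝ) < 2 ^ s.length := by positivity
  rw [segmentQuotient, norm_smul, Real.norm_of_nonneg hc.le]
  calc (2 : ℝ) ^ s.length * _ ≤ 2 ^ s.length * (B * ‖((2 : ℝ) ^ s.length)⁻¹ • x s‖) := by
        gcongr
        simpa using hf (segmentStart x s.reverse + ((2 : ℝ) ^ s.length)⁻¹ • x s)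
          (segmentStart x s.reverse)
    _ = B * ‖x s‖ := by
        rw [norm_smul, Real.norm_of_nonneg (inv_pos.2 hc).le]
        field_simp
    _ ≤ B := mul_le_of_le_one_right hB (hx s)

theorem segmentQuotient_append_false (s : List (Bool × ℕ)) (n : ℕ) :
    segmentQuotient f x (s ++ [(false, n)]) = (2 : ℝ) ^ (s.length + 1) •
      (f (segmentStart x s.reverse + ((2 : ℝ) ^ (s.length + 1))⁻¹ • x (s ++ [(false, n)])) -
        f (segmentStart x s.reverse)) := by
  simp [segmentQuotient, segmentStart]

theorem segmentQuotient_append_true {s : List (Bool × ℕ)} {n : ℕ}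
    (h : x s = (2⁻¹ : ℝ) • (x (s ++ [(false, n)]) + x (s ++ [(true, n)]))) :
    segmentQuotient f x (s ++ [(true, n)]) = (2 : ℝ) ^ (s.length + 1) •
      (f (segmentStart x s.reverse + ((2 : ℝ) ^ s.length)⁻¹ • x s) -
        f (segmentStart x s.reverse +
          ((2 : ℝ) ^ (s.length + 1))⁻¹ • x (s ++ [(false, n)]))) := by
  have hsplit : ((2 : ℝ) ^ s.length)⁻¹ • x s =
      ((2 : ℝ) ^ (s.length + 1))⁻¹ • x (s ++ [(false, n)]) +
        ((2 : ℝ) ^ (s.length + 1))⁻¹ • x (s ++ [(true, n)]) := by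
    rw [h, smul_smul, ← smul_add, pow_succ, mul_inv]
  rw [hsplit, ← add_assoc]
  simp [segmentQuotient, segmentStart]

theorem segmentQuotient_eq_midpoint {s : List (Bool × ℕ)} {n : ℕ}
    (h : x s = (2⁻¹ : ℝ) • (x (s ++ [(false, n)]) + x (s ++ [(true, n)]))) :
    segmentQuotient f x s = (2⁻¹ : ℝ) •
      (segmentQuotient f x (s ++ [(false, n)]) + segmentQuotient f x (s ++ [(true, n)])) := by
  rw [segmentQuotient_append_false, segmentQuotient_append_true f x h, ← smul_add,
    sub_add_sub_cancel', smul_smul, pow_succ', inv_mul_cancel_left₀ two_ne_zero, segmentQuotient]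

theorem le_norm_segmentQuotient_sub {A : ℝ} (hf : ∀ u v, A * ‖u - v‖ ≤ ‖f u - f v‖)
    (s : List (Bool × ℕ)) (n m : ℕ) :
    A * ‖x (s ++ [(false, n)]) - x (s ++ [(false, m)])‖ ≤
      ‖segmentQuotient f x (s ++ [(false, n)]) - segmentQuotient f x (s ++ [(false, m)])‖ := by
  have hc : (0 : ℝ) < 2 ^ (s.length + 1) := by positivity
  rw [segmentQuotient_append_false, segmentQuotient_append_false, ← smul_sub,
    sub_sub_sub_cancel_right, norm_smul, Real.norm_of_nonneg hc.le]
  refine le_trans (le_of_eq ?_) (mul_le_mul_of_nonneg_left (hf _ _) hc.le)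
  rw [add_sub_add_left_eq_sub, ← smul_sub, norm_smul, Real.norm_of_nonneg (inv_pos.2 hc).le]
  field_simp

end segmentQuotient

/-- If `X` fails the Infinite Sprawling Tree Property and `Y` bi-Lipschitz
embeds into `X`, then `Y` fails the Infinite Sprawling Tree Property. -/
theorem statement17 {X Y : Type*} [NormedAddCommGroup X] [NormedSpace ℝ X] [CompleteSpace X]
    [NormedAddCommGroup Y] [NormedSpace ℝ Y] [CompleteSpace Y]
    (hX : ¬ InfiniteSprawlingTreeProperty X) (hemb : ∃ f : Y → X, IsBiLipEmb f) :
    ¬ InfiniteSprawlingTreeProperty Y := by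
  obtain ⟨f, A, B, hA, hAB, hf⟩ := hemb
  have hB : 0 < B := hA.trans_le hAB
  rintro ⟨δ, hδ, x, hx, hxt⟩
  refine hX ⟨B⁻¹ * (A * δ), by positivity, fun s => B⁻¹ • segmentQuotient f x s, fun s => ?_,
    fun s => ⟨fun n => ?_, fun n m hnm => ?_⟩⟩
  · rw [norm_smul, Real.norm_of_nonneg (inv_pos.2 hB).le, inv_mul_le_one₀ hB]
    exact norm_segmentQuotient_le f x hB.le (fun u v => (hf u v).2) hx s
  · simp only
    rw [segmentQuotient_eq_midpoint f x ((hxt s).1 n), ← smul_add, smul_comm]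
  · rw [← smul_sub, norm_smul, Real.norm_of_nonneg (inv_pos.2 hB).le]
    gcongr
    exact (mul_le_mul_of_nonneg_left ((hxt s).2 n m hnm) hA.le).trans
      (le_norm_segmentQuotient_sub f x (fun u v => (hf u v).1) s n m)
end
end

section
/- Let X be a separable Banach space such that every countable complete metric space bi-Lipschitz embeds into X. Then X has the Infinite Sprawling Tree Property and fails the Slice Point of Continuity Property. In particular, if c₀ bi-Lipschitz embeds into a separable Banach space X, then X fails the Slice Point of Continuity Property. -/
open Metric Set Topology

noncomputable section

variable {X : Type*} [NormedAddCommGroup X] [NormedSpace ℝ X]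

open ZeroAtInfty

/-- If `n ↦ y n` is `δ`-separated and every `½(y n + z m)` lies in a bounded set `A`, then each
`x = ½(y n + z n)` has only weak neighborhoods of diameter at least `δ / 2` in `A`. -/
lemma half_le_diam_of_mem_weak_nhds {A : Set X} (hA : Bornology.IsBounded A) {x : X} {δ R : ℝ}
    {y z : ℕ → X} (hx : ∀ n, x = (2⁻¹ : ℝ) • (y n + z n)) (hy : ∀ n, ‖y n‖ ≤ R)
    (hA' : ∀ n m, (2⁻¹ : ℝ) • (y n + z m) ∈ A) (hsep : ∀ n m, n ≠ m → δ ≤ ‖y n - y m‖)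
    {V : Set X} (hV : V ∈ @nhds X (weakTop X) x) : δ / 2 ≤ Metric.diam (V ∩ A) := by
  rw [weakTop, nhds_induced, Filter.mem_comap] at hV
  obtain ⟨U, hU, hUV⟩ := hV
  let φ : X → (X →L[ℝ] ℝ) → ℝ := fun x f => f x
  have hK : IsCompact (Set.univ.pi fun f : X →L[ℝ] ℝ => Metric.closedBall (0 : ℝ) (‖f‖ * R)) :=
    isCompact_univ_pi fun f => isCompact_closedBall _ _
  have hmem : ∀ n, φ (y n) ∈
      Set.univ.pi fun f : X →L[ℝ] ℝ => Metric.closedBall (0 : ℝ) (‖f‖ * R) := by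
    intro n f _
    rw [mem_closedBall_zero_iff]
    exact (f.le_opNorm _).trans (by gcongr; exact hy n)
  obtain ⟨p, -, hp⟩ := hK (f := Filter.map (fun n => φ (y n)) Filter.atTop)
    (Filter.le_principal_iff.2 <| Filter.mem_map.2 <| Filter.univ_mem' hmem)
  have hcont : Continuous fun q : ((X →L[ℝ] ℝ) → ℝ) × ((X →L[ℝ] ℝ) → ℝ) =>
      φ x + (2⁻¹ : ℝ) • (q.1 - q.2) := by fun_prop
  have hpre := hcont.continuousAt (x := (p, p)) |>.preimage_mem_nhds (t := U) (by simpa using hU)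
  rw [nhds_prod_eq, Filter.mem_prod_same_iff] at hpre
  obtain ⟨N, hN, hNU⟩ := hpre
  have hfreq : ∃ᶠ n in Filter.atTop, φ (y n) ∈ N :=
    (show MapClusterPt p Filter.atTop (fun n => φ (y n)) from hp).frequently hN
  obtain ⟨n, -, hn⟩ := (Filter.frequently_atTop.1 hfreq) 0
  obtain ⟨m, hm, hm'⟩ := (Filter.frequently_atTop.1 hfreq) (n + 1)
  have hq : (2⁻¹ : ℝ) • (y n + z m) = x + (2⁻¹ : ℝ) • (y n - y m) := by
    rw [hx m]; module
  have hqV : (2⁻¹ : ℝ) • (y n + z m) ∈ V := by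
    apply hUV
    have := hNU (Set.mk_mem_prod hn hm')
    rw [Set.mem_preimage] at this ⊢
    convert this using 1
    ext f
    simp [φ, hq]
  have hxV : x ∈ V := hUV (by simpa using mem_of_mem_nhds hU)
  have hxA : x ∈ A := hx n ▸ hA' n n
  have hd := Metric.dist_le_diam_of_mem (hA.subset Set.inter_subset_right)
    (show _ ∈ V ∩ A from ⟨hqV, hA' n m⟩) ⟨hxV, hxA⟩
  rw [dist_eq_norm, hq, add_sub_cancel_left, norm_smul] at hd
  have := hsep n m (by omega)
  norm_num at hd
  linarith

/-- The Infinite Sprawling Tree Property contradicts the Slice PCP. -/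
lemma InfiniteSprawlingTreeProperty.not_slicePCP (h : InfiniteSprawlingTreeProperty X) :
    ¬ SlicePCP X := by
  obtain ⟨δ, hδ, x, hx, htree⟩ := h
  intro hS
  have hb : Bornology.IsBounded (convexHull ℝ (Set.range x)) := by
    rw [isBounded_convexHull]
    exact (Metric.isBounded_closedBall (x := (0 : X)) (r := 1)).subset
      (Set.range_subset_iff.2 fun s => mem_closedBall_zero_iff.2 (hx s))
  have hmem : ∀ s, x s ∈ convexHull ℝ (Set.range x) := fun s =>
    subset_convexHull ℝ _ ⟨s, rfl⟩
  obtain ⟨f, a, ⟨u, hu, huA⟩, hfa⟩ := hS _ ⟨_, hmem []⟩ hb (δ / 2) (by positivity)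
  have : ∃ s, a < f (x s) := by
    by_contra! hle
    have hsub : convexHull ℝ (Set.range x) ⊆ {y | f y ≤ a} :=
      convexHull_min (Set.range_subset_iff.2 hle)
        (convex_halfSpace_le f.toLinearMap.isLinear a)
    exact not_lt.2 (show f u ≤ a from hsub huA) hu
  obtain ⟨s, hs⟩ := this
  obtain ⟨V, hV, hVd⟩ := hfa (x s) ⟨hs, hmem s⟩
  refine hVd.not_ge (half_le_diam_of_mem_weak_nhds hb (htree s).1 (fun n => hx _) (fun n m => ?_)
    (htree s).2 hV)
  rw [smul_add]
  exact convex_convexHull ℝ _ (hmem _) (hmem _) (by norm_num) (by norm_num) (by norm_num)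

/-- A bounded sprawling tree, indexed by finite sequences with their latest entry first, yields
the Infinite Sprawling Tree Property. -/
lemma infiniteSprawlingTreeProperty_of_bounded {δ R : ℝ} (hδ : 0 < δ) (hR : 0 < R)
    (x : List (Bool × ℕ) → X) (hx : ∀ s, ‖x s‖ ≤ R)
    (hmid : ∀ s n, x s = (2⁻¹ : ℝ) • (x ((false, n) :: s) + x ((true, n) :: s)))
    (hsep : ∀ s n m, n ≠ m → δ ≤ ‖x ((false, n) :: s) - x ((false, m) :: s)‖) :
    InfiniteSprawlingTreeProperty X := by
  refine ⟨R⁻¹ * δ, by positivity, fun s => R⁻¹ • x s.reverse, fun s => ?_, fun s => ⟨fun n => ?_,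
    fun n m hnm => ?_⟩⟩
  · rw [norm_smul, Real.norm_of_nonneg (by positivity), inv_mul_le_iff₀ hR, mul_one]
    exact hx _
  · simp only [List.reverse_append, List.reverse_singleton, List.singleton_append]
    rw [hmid s.reverse n]
    module
  · simp only [List.reverse_append, List.reverse_singleton, List.singleton_append]
    rw [← smul_sub, norm_smul, Real.norm_of_nonneg (by positivity)]
    gcongr
    exact hsep _ n m hnm

/-- If a nonempty bounded set `C` lies in the closure of the set of points having a `δ`-separated
sprawling of height one in `C`, then the Infinite Sprawling Tree Property holds. -/
lemma infiniteSprawlingTreeProperty_of_approx {δ R : ℝ} (hδ : 0 < δ) {C : Set X}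
    (hne : C.Nonempty) (hR : ∀ u ∈ C, ‖u‖ ≤ R)
    (hC : ∀ u ∈ C, ∀ ε > (0 : ℝ), ∃ v : X, ‖u - v‖ < ε ∧ ∃ y z : ℕ → X, (∀ n, y n ∈ C) ∧
      (∀ n, z n ∈ C) ∧ (∀ n, v = (2⁻¹ : ℝ) • (y n + z n)) ∧
      ∀ n m, n ≠ m → δ ≤ ‖y n - y m‖) : InfiniteSprawlingTreeProperty X := by
  choose v hv y z hy hz hvyz hsep using fun u : C => hC u u.2
  obtain ⟨u₀, hu₀⟩ := hne
  have hpos : ∀ s : List (Bool × ℕ), (0 : ℝ) < 2⁻¹ ^ (s.length + 1) := fun s => by positivity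
  let a : List (Bool × ℕ) → C := fun l => List.rec ⟨u₀, hu₀⟩ (fun p s c => bif p.1 then
    ⟨z c _ (hpos s) p.2, hz c _ (hpos s) p.2⟩ else ⟨y c _ (hpos s) p.2, hy c _ (hpos s) p.2⟩) l
  let w : List (Bool × ℕ) → X := fun l => List.rec (motive := fun _ => X) 0
    (fun _ s c => c + ((a s).1 - v (a s) _ (hpos s))) l
  have haf : ∀ s n, (a ((false, n) :: s) : X) = y (a s) _ (hpos s) n := fun s n => rfl
  have hat : ∀ s n, (a ((true, n) :: s) : X) = z (a s) _ (hpos s) n := fun s n => rfl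
  have hw : ∀ p s, w (p :: s) = w s + ((a s).1 - v (a s) _ (hpos s)) := fun p s => rfl
  have hwb : ∀ s, ‖w s‖ ≤ 1 - 2⁻¹ ^ s.length := by
    intro s
    induction s with
    | nil => simp [w]
    | cons p s ih =>
      rw [hw p s]
      refine (norm_add_le _ _).trans ?_
      have := hv (a s) _ (hpos s)
      rw [List.length_cons]
      have h2 : (2⁻¹ : ℝ) ^ s.length = 2 * 2⁻¹ ^ (s.length + 1) := by rw [pow_succ]; ring
      linarith
  have hR0 : 0 ≤ R := (norm_nonneg _).trans (hR _ hu₀)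
  refine infiniteSprawlingTreeProperty_of_bounded hδ (R := R + 1) (by linarith)
    (fun s => (a s).1 + w s) (fun s => ?_) (fun s n => ?_) (fun s n m hnm => ?_)
  · have := hpos s
    have h0 : (0 : ℝ) < 2⁻¹ ^ s.length := by positivity
    linarith [norm_add_le (a s).1 (w s), hR _ (a s).2, hwb s]
  · simp only [hw, haf, hat]
    have := hvyz (a s) _ (hpos s) n
    set q := v (a s) _ (hpos s)
    rw [show (2⁻¹ : ℝ) • (y (a s) _ (hpos s) n + (w s + ((a s).1 - q)) +
      (z (a s) _ (hpos s) n + (w s + ((a s).1 - q)))) =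
      (2⁻¹ : ℝ) • (y (a s) _ (hpos s) n + z (a s) _ (hpos s) n) + (w s + ((a s).1 - q)) by module,
      ← this]
    abel
  · simp only [hw, haf, add_sub_add_right_eq_sub]
    exact hsep _ _ _ n m hnm

/-- The `k`-th unit vector of `c₀`. -/
def c0Single (k : ℕ) : C₀(ℕ, ℝ) where
  toFun := Pi.single k 1
  continuous_toFun := continuous_of_discreteTopology
  zero_at_infty' := by
    rw [Filter.cocompact_eq_cofinite]
    refine tendsto_const_nhds.congr' ?_
    filter_upwards [(Set.finite_singleton k).compl_mem_cofinite] with i hi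
    exact (Pi.single_eq_of_ne (M := fun _ => ℝ) (by simpa using hi) _).symm

lemma c0Single_self (k : ℕ) : c0Single k k = 1 := Pi.single_eq_same (M := fun _ => ℝ) k 1

lemma c0Single_of_ne {k i : ℕ} (h : i ≠ k) : c0Single k i = 0 :=
  Pi.single_eq_of_ne (M := fun _ => ℝ) h 1

lemma abs_apply_le_c0_norm (u : C₀(ℕ, ℝ)) (i : ℕ) : |u i| ≤ ‖u‖ := by
  rw [← ZeroAtInftyContinuousMap.norm_toBCF_eq_norm]
  exact u.toBCF.norm_coe_le_norm i

lemma c0_norm_le {u : C₀(ℕ, ℝ)} {r : ℝ} (hr : 0 ≤ r) (h : ∀ i, |u i| ≤ r) : ‖u‖ ≤ r := by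
  rw [← ZeroAtInftyContinuousMap.norm_toBCF_eq_norm]
  exact (BoundedContinuousFunction.norm_le hr).2 h

/-- The coordinate used by the `n`-th midpoint of the diamond at `σ`. -/
def diamondCoord (σ : List (Bool × ℕ)) (n : ℕ) : ℕ := Encodable.encode ((false, n) :: σ)

lemma diamondCoord_inj {σ τ : List (Bool × ℕ)} {n m : ℕ} :
    diamondCoord σ n = diamondCoord τ m ↔ n = m ∧ σ = τ := by
  simp [diamondCoord, Encodable.encode_inj]

/-- The poles of the infinitely branching diamond at `σ`, whose latest entry comes first: passing
from `σ` to `(b, n) :: σ` replaces one of the poles, according to `b`, by the `n`-th midpoint. -/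
def diamondPoles : List (Bool × ℕ) → C₀(ℕ, ℝ) × C₀(ℕ, ℝ)
  | [] => (0, c0Single 0)
  | (b, n) :: σ =>
    let p := diamondPoles σ
    let m := (2⁻¹ : ℝ) • (p.1 + p.2) +
      (2⁻¹ : ℝ) ^ (σ.length + 1) • c0Single (diamondCoord σ n)
    bif b then (m, p.2) else (p.1, m)

/-- The `n`-th midpoint of the poles at `σ`. -/
def diamondMid (σ : List (Bool × ℕ)) (n : ℕ) : C₀(ℕ, ℝ) :=
  (2⁻¹ : ℝ) • ((diamondPoles σ).1 + (diamondPoles σ).2) +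
    (2⁻¹ : ℝ) ^ (σ.length + 1) • c0Single (diamondCoord σ n)

lemma diamondPoles_false (σ : List (Bool × ℕ)) (n : ℕ) :
    diamondPoles ((false, n) :: σ) = ((diamondPoles σ).1, diamondMid σ n) := rfl

lemma diamondPoles_true (σ : List (Bool × ℕ)) (n : ℕ) :
    diamondPoles ((true, n) :: σ) = (diamondMid σ n, (diamondPoles σ).2) := rfl

/-- The poles at `τ` are supported on the coordinates introduced on the way to `τ`. -/
lemma diamondPoles_apply_eq_zero {σ : List (Bool × ℕ)} {n : ℕ} :
    ∀ τ : List (Bool × ℕ), (∀ b, ¬ ((b, n) :: σ) <:+ τ) →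
      (diamondPoles τ).1 (diamondCoord σ n) = 0 ∧ (diamondPoles τ).2 (diamondCoord σ n) = 0 := by
  intro τ
  induction τ with
  | nil =>
    intro _
    refine ⟨rfl, c0Single_of_ne fun h => ?_⟩
    simp [diamondCoord] at h
  | cons p τ ih =>
    intro h
    obtain ⟨b, m⟩ := p
    obtain ⟨h1, h2⟩ := ih fun b' hb' => h b' (hb'.trans (List.suffix_cons _ _))
    have hm : diamondMid τ m (diamondCoord σ n) = 0 := by
      have : diamondCoord σ n ≠ diamondCoord τ m := by
        rw [Ne, diamondCoord_inj]
        rintro ⟨rfl, rfl⟩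
        exact h b List.suffix_rfl
      simp [diamondMid, h1, h2, c0Single_of_ne this]
    cases b
    · exact ⟨h1, hm⟩
    · exact ⟨hm, h2⟩

lemma not_cons_suffix_self {α : Type*} (a : α) (l : List α) : ¬ (a :: l) <:+ l := fun h => by
  simpa using h.length_le

lemma diamondMid_apply_self (σ : List (Bool × ℕ)) (n : ℕ) :
    diamondMid σ n (diamondCoord σ n) = 2⁻¹ ^ (σ.length + 1) := by
  obtain ⟨h1, h2⟩ := diamondPoles_apply_eq_zero (n := n) σ fun b => not_cons_suffix_self _ _
  simp [diamondMid, h1, h2, c0Single_self]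

lemma norm_half_smul_add_single_le {u : C₀(ℕ, ℝ)} {r ε : ℝ} {k : ℕ} (hu : ‖u‖ ≤ 2 * r)
    (hr : 0 ≤ r) (hk : u k = 0) (hε : |ε| ≤ r) :
    ‖(2⁻¹ : ℝ) • u + ε • c0Single k‖ ≤ r := by
  refine c0_norm_le hr fun i => ?_
  rcases eq_or_ne i k with rfl | hi
  · simpa [hk, c0Single_self] using hε
  · have := (abs_apply_le_c0_norm u i).trans hu
    simp only [ZeroAtInftyContinuousMap.add_apply, ZeroAtInftyContinuousMap.smul_apply,
      c0Single_of_ne hi, smul_eq_mul, mul_zero, add_zero, abs_mul]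
    norm_num
    linarith

lemma norm_diamondPoles_sub_le (σ : List (Bool × ℕ)) :
    ‖(diamondPoles σ).1 - (diamondPoles σ).2‖ ≤ 2⁻¹ ^ σ.length := by
  induction σ with
  | nil =>
    refine c0_norm_le (by simp) fun i => ?_
    rcases eq_or_ne i 0 with rfl | hi
    · simp [diamondPoles, c0Single_self]
    · simp [diamondPoles, c0Single_of_ne hi]
  | cons p σ ih =>
    obtain ⟨b, n⟩ := p
    obtain ⟨h1, h2⟩ := diamondPoles_apply_eq_zero (n := n) σ fun b => not_cons_suffix_self _ _
    have hr : (2⁻¹ : ℝ) ^ σ.length = 2 * 2⁻¹ ^ (σ.length + 1) := by rw [pow_succ]; ring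
    rw [hr] at ih
    have hpos : (0 : ℝ) ≤ 2⁻¹ ^ (σ.length + 1) := by positivity
    cases b
    · rw [diamondPoles_false, List.length_cons]
      convert norm_half_smul_add_single_le (k := diamondCoord σ n) ih hpos (by simp [h1, h2])
        (ε := -2⁻¹ ^ (σ.length + 1)) (by rw [abs_neg, abs_of_nonneg hpos]) using 2
      rw [diamondMid]
      module
    · rw [diamondPoles_true, List.length_cons]
      convert norm_half_smul_add_single_le (k := diamondCoord σ n) ih hpos (by simp [h1, h2])
        (ε := 2⁻¹ ^ (σ.length + 1)) (by rw [abs_of_nonneg hpos]) using 2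
      rw [diamondMid]
      module

lemma le_norm_diamondMid_sub (σ : List (Bool × ℕ)) {n m : ℕ} (h : n ≠ m) :
    2⁻¹ ^ (σ.length + 1) ≤ ‖diamondMid σ n - diamondMid σ m‖ := by
  refine le_trans (le_of_eq ?_) (abs_apply_le_c0_norm _ (diamondCoord σ n))
  have : diamondCoord σ n ≠ diamondCoord σ m := by simpa [diamondCoord_inj] using h
  simp [diamondMid, c0Single_self, c0Single_of_ne this]

/-- The poles at a descendant `τ` of `ρ` lie in order on a geodesic between the poles at `ρ`. -/
lemma diamondPoles_geodesic {ρ τ : List (Bool × ℕ)} (h : ρ <:+ τ) :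
    ‖(diamondPoles ρ).1 - (diamondPoles τ).1‖ + 2⁻¹ ^ τ.length +
      ‖(diamondPoles τ).2 - (diamondPoles ρ).2‖ ≤ 2⁻¹ ^ ρ.length := by
  obtain ⟨l, rfl⟩ := h
  induction l with
  | nil => simp
  | cons p l ih =>
    obtain ⟨b, n⟩ := p
    rw [List.cons_append, List.length_cons]
    have hr : (2⁻¹ : ℝ) ^ (l ++ ρ).length = 2 * 2⁻¹ ^ ((l ++ ρ).length + 1) := by
      rw [pow_succ]; ring
    set τ := l ++ ρ
    have hf := norm_diamondPoles_sub_le ((false, n) :: τ)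
    have ht := norm_diamondPoles_sub_le ((true, n) :: τ)
    rw [diamondPoles_false, List.length_cons] at hf
    rw [diamondPoles_true, List.length_cons] at ht
    cases b
    · rw [diamondPoles_false]
      have := norm_sub_le_norm_sub_add_norm_sub (diamondMid τ n) (diamondPoles τ).2
        (diamondPoles ρ).2
      dsimp only at hf ht ⊢
      linarith
    · rw [diamondPoles_true]
      have := norm_sub_le_norm_sub_add_norm_sub (diamondPoles ρ).1 (diamondPoles τ).1
        (diamondMid τ n)
      dsimp only at hf ht ⊢
      linarith

/-- All poles at descendants of `σ` with index in `T`. -/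
def diamondSet (T : Set (List (Bool × ℕ))) (σ : List (Bool × ℕ)) : Set C₀(ℕ, ℝ) :=
  {q | ∃ τ ∈ T, σ <:+ τ ∧ (q = (diamondPoles τ).1 ∨ q = (diamondPoles τ).2)}

lemma diamondSet_add_norm_le {T : Set (List (Bool × ℕ))} {σ : List (Bool × ℕ)} {q : C₀(ℕ, ℝ)}
    (h : q ∈ diamondSet T σ) :
    ‖q - (diamondPoles σ).1‖ + ‖q - (diamondPoles σ).2‖ ≤ 2⁻¹ ^ σ.length := by
  obtain ⟨τ, -, hστ, rfl | rfl⟩ := h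
  · have h1 := diamondPoles_geodesic hστ
    have h2 := norm_diamondPoles_sub_le τ
    have := norm_sub_le_norm_sub_add_norm_sub (diamondPoles τ).1 (diamondPoles τ).2
      (diamondPoles σ).2
    rw [norm_sub_rev (diamondPoles τ).1 (diamondPoles σ).1]
    linarith
  · have h1 := diamondPoles_geodesic hστ
    have h2 := norm_diamondPoles_sub_le τ
    have := norm_sub_le_norm_sub_add_norm_sub (diamondPoles τ).2 (diamondPoles τ).1
      (diamondPoles σ).1
    rw [norm_sub_rev (diamondPoles τ).2 (diamondPoles τ).1,
      norm_sub_rev (diamondPoles τ).1 (diamondPoles σ).1] at this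
    linarith

/-- A point in the half `b` of the `n`-th branch at `σ` is as far from one of the poles at `σ`
as its `n`-th coordinate tells. -/
lemma diamondSet_cons_norm_le {T : Set (List (Bool × ℕ))} {σ : List (Bool × ℕ)} {q : C₀(ℕ, ℝ)}
    {b : Bool} {n : ℕ} (h : q ∈ diamondSet T ((b, n) :: σ)) :
    ‖q - (diamondPoles σ).1‖ ≤ |q (diamondCoord σ n)| ∨
      ‖q - (diamondPoles σ).2‖ ≤ |q (diamondCoord σ n)| := by
  have hs := diamondSet_add_norm_le h
  rw [List.length_cons] at hs
  have hm := abs_apply_le_c0_norm (q - diamondMid σ n) (diamondCoord σ n)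
  rw [ZeroAtInftyContinuousMap.sub_apply, diamondMid_apply_self] at hm
  have hm' := (neg_le_abs _).trans hm
  have := le_abs_self (q (diamondCoord σ n))
  cases b
  · left
    rw [diamondPoles_false] at hs
    dsimp only at hs
    linarith
  · right
    rw [diamondPoles_true] at hs
    dsimp only at hs
    linarith

lemma diamondSet_cons_apply_eq_zero {T : Set (List (Bool × ℕ))} {σ : List (Bool × ℕ)}
    {q : C₀(ℕ, ℝ)} {b : Bool} {n m : ℕ} (h : q ∈ diamondSet T ((b, m) :: σ)) (hnm : n ≠ m) :
    q (diamondCoord σ n) = 0 := by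
  obtain ⟨τ, -, hτ, hq⟩ := h
  have := diamondPoles_apply_eq_zero (σ := σ) (n := n) τ fun b' hb' => by
    have := (List.suffix_of_suffix_length_le hb' hτ (by simp)).eq_of_length (by simp)
    simp_all
  rcases hq with rfl | rfl
  exacts [this.1, this.2]

lemma diamondSet_subset {T : Set (List (Bool × ℕ))} {σ τ : List (Bool × ℕ)} (h : σ <:+ τ) :
    diamondSet T τ ⊆ diamondSet T σ := fun _ ⟨ρ, hρ, hτρ, hq⟩ => ⟨ρ, hρ, h.trans hτρ, hq⟩

lemma mem_diamondSet {T : Set (List (Bool × ℕ))} {σ : List (Bool × ℕ)} {q : C₀(ℕ, ℝ)}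
    (h : q ∈ diamondSet T σ) :
    (q = (diamondPoles σ).1 ∨ q = (diamondPoles σ).2) ∨
      ∃ b n, q ∈ diamondSet T ((b, n) :: σ) := by
  obtain ⟨τ, hτ, ⟨l, rfl⟩, hq⟩ := h
  rcases List.eq_nil_or_concat l with rfl | ⟨l', ⟨b, n⟩, rfl⟩
  · exact .inl hq
  · exact .inr ⟨b, n, _, hτ, ⟨l', by simp⟩, hq⟩

/-- If the sets attached to all children of `σ ∈ T` are closed, so is the one attached to `σ`. -/
lemma isClosed_diamondSet_of_children {T : Set (List (Bool × ℕ))} {σ : List (Bool × ℕ)}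
    (hσ : σ ∈ T) (h : ∀ b n, IsClosed (diamondSet T ((b, n) :: σ))) :
    IsClosed (diamondSet T σ) := by
  refine isClosed_of_closure_subset fun p hp => ?_
  by_cases h1 : p = (diamondPoles σ).1
  · exact ⟨σ, hσ, List.suffix_rfl, .inl h1⟩
  by_cases h2 : p = (diamondPoles σ).2
  · exact ⟨σ, hσ, List.suffix_rfl, .inr h2⟩
  obtain ⟨η, hη, hη1, hη2⟩ : ∃ η > 0, η ≤ ‖p - (diamondPoles σ).1‖ ∧
      η ≤ ‖p - (diamondPoles σ).2‖ :=
    ⟨min ‖p - (diamondPoles σ).1‖ ‖p - (diamondPoles σ).2‖,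
      lt_min (norm_sub_pos_iff.2 h1) (norm_sub_pos_iff.2 h2), min_le_left _ _, min_le_right _ _⟩
  have hfar : ∀ q, ‖p - q‖ < η / 4 →
      η * (3 / 4) < ‖q - (diamondPoles σ).1‖ ∧ η * (3 / 4) < ‖q - (diamondPoles σ).2‖ := by
    intro q hq
    constructor
    · linarith [norm_sub_le_norm_sub_add_norm_sub p q (diamondPoles σ).1]
    · linarith [norm_sub_le_norm_sub_add_norm_sub p q (diamondPoles σ).2]
  have hchild : ∀ q ∈ diamondSet T σ, ‖p - q‖ < η / 4 →
      ∃ b n, q ∈ diamondSet T ((b, n) :: σ) := by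
    intro q hq hpq
    refine (mem_diamondSet hq).resolve_left ?_
    obtain ⟨hf1, hf2⟩ := hfar q hpq
    rintro (rfl | rfl)
    · rw [sub_self, norm_zero] at hf1; linarith
    · rw [sub_self, norm_zero] at hf2; linarith
  have hp' := Metric.mem_closure_iff.1 hp
  simp only [dist_eq_norm] at hp'
  obtain ⟨q, hq, hpq⟩ := hp' (η / 4) (by positivity)
  obtain ⟨b, n, hqn⟩ := hchild q hq hpq
  have hclosed := (h false n).union (h true n)
  suffices p ∈ diamondSet T ((false, n) :: σ) ∪ diamondSet T ((true, n) :: σ) by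
    rcases this with h | h <;> exact diamondSet_subset (List.suffix_cons _ _) h
  rw [← hclosed.closure_eq]
  refine Metric.mem_closure_iff.2 fun ε hε => ?_
  obtain ⟨q', hq', hpq'⟩ := hp' (min ε (η / 4)) (by positivity)
  obtain ⟨b', m, hqm⟩ := hchild q' hq' (hpq'.trans_le (min_le_right _ _))
  have hnm : n = m := by
    by_contra hnm
    have hc := abs_apply_le_c0_norm (q - q') (diamondCoord σ n)
    rw [ZeroAtInftyContinuousMap.sub_apply, diamondSet_cons_apply_eq_zero hqm hnm, sub_zero] at hc
    have hd := norm_sub_le_norm_sub_add_norm_sub q p q'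
    rw [norm_sub_rev q p] at hd
    have := hpq'.trans_le (min_le_right _ _)
    obtain ⟨hf1, hf2⟩ := hfar q hpq
    rcases diamondSet_cons_norm_le hqn with h | h <;> linarith
  subst hnm
  refine ⟨q', ?_, by rw [dist_eq_norm]; exact hpq'.trans_le (min_le_left _ _)⟩
  cases b'
  exacts [.inl hqm, .inr hqm]

lemma countable_diamondSet (T : Set (List (Bool × ℕ))) (σ : List (Bool × ℕ)) :
    (diamondSet T σ).Countable := by
  refine ((Set.countable_range fun τ => (diamondPoles τ).1).union
    (Set.countable_range fun τ => (diamondPoles τ).2)).mono ?_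
  rintro _ ⟨τ, -, -, rfl | rfl⟩
  exacts [.inl ⟨τ, rfl⟩, .inr ⟨τ, rfl⟩]

/-- The normalized increment of `f` between the poles at `σ`. -/
def diamondQuot (f : C₀(ℕ, ℝ) → X) (σ : List (Bool × ℕ)) : X :=
  (2 : ℝ) ^ σ.length • (f (diamondPoles σ).2 - f (diamondPoles σ).1)

lemma diamondQuot_eq_half (f : C₀(ℕ, ℝ) → X) (σ : List (Bool × ℕ)) (n : ℕ) :
    diamondQuot f σ =
      (2⁻¹ : ℝ) • (diamondQuot f ((false, n) :: σ) + diamondQuot f ((true, n) :: σ)) := by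
  simp only [diamondQuot, diamondPoles_false, diamondPoles_true, List.length_cons, pow_succ]
  module

lemma norm_diamondQuot_le {f : C₀(ℕ, ℝ) → X} {σ : List (Bool × ℕ)} {B : ℝ} (hB : 0 ≤ B)
    (h : ‖f (diamondPoles σ).2 - f (diamondPoles σ).1‖ ≤
      B * ‖(diamondPoles σ).2 - (diamondPoles σ).1‖) : ‖diamondQuot f σ‖ ≤ B := by
  have h1 := norm_diamondPoles_sub_le σ
  rw [norm_sub_rev] at h1
  rw [diamondQuot, norm_smul, norm_pow, Real.norm_ofNat]
  calc (2 : ℝ) ^ σ.length * ‖f (diamondPoles σ).2 - f (diamondPoles σ).1‖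
      ≤ 2 ^ σ.length * (B * 2⁻¹ ^ σ.length) := by
        gcongr
        exact h.trans (by gcongr)
    _ = B := by rw [inv_pow]; field_simp

lemma le_norm_diamondQuot_sub {f : C₀(ℕ, ℝ) → X} {σ : List (Bool × ℕ)} {A : ℝ} (hA : 0 ≤ A)
    {n m : ℕ} (hnm : n ≠ m) (h : A * ‖diamondMid σ n - diamondMid σ m‖ ≤
      ‖f (diamondMid σ n) - f (diamondMid σ m)‖) :
    A ≤ ‖diamondQuot f ((false, n) :: σ) - diamondQuot f ((false, m) :: σ)‖ := by
  simp only [diamondQuot, diamondPoles_false, List.length_cons]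
  rw [← smul_sub, sub_sub_sub_cancel_right, norm_smul, norm_pow, Real.norm_ofNat]
  calc A = 2 ^ (σ.length + 1) * (A * 2⁻¹ ^ (σ.length + 1)) := by rw [inv_pow]; field_simp
    _ ≤ _ := by
      gcongr
      exact le_trans (by gcongr; exact le_norm_diamondMid_sub σ hnm) h

lemma infiniteSprawlingTreeProperty_of_c0_embedding {f : C₀(ℕ, ℝ) → X} {A B : ℝ} (hA : 0 < A)
    (hAB : A ≤ B) (hf : ∀ u v, A * ‖u - v‖ ≤ ‖f u - f v‖ ∧ ‖f u - f v‖ ≤ B * ‖u - v‖) :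
    InfiniteSprawlingTreeProperty X :=
  infiniteSprawlingTreeProperty_of_bounded hA (hA.trans_le hAB) (diamondQuot f)
    (fun _ => norm_diamondQuot_le (hA.le.trans hAB) (hf _ _).2) (diamondQuot_eq_half f)
    fun _ _ _ hnm => le_norm_diamondQuot_sub hA.le hnm (hf _ _).1

/-- Pairs `(k, x)` such that `x` has a `1 / (k + 1)`-separated sprawling of height one in the
section of `C` at `k`. -/
def sprawlStep (C : Set (ℕ × X)) : Set (ℕ × X) :=
  {p | ∃ y z : ℕ → X, (∀ n, (p.1, y n) ∈ C) ∧ (∀ n, (p.1, z n) ∈ C) ∧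
    (∀ n, p.2 = (2⁻¹ : ℝ) • (y n + z n)) ∧ ∀ n m, n ≠ m → ((p.1 : ℝ) + 1)⁻¹ ≤ ‖y n - y m‖}

/-- The transfinite iteration of `closure ∘ sprawlStep`, starting from the balls of radius
`k + 1`. -/
def sprawlSet (X : Type*) [NormedAddCommGroup X] [NormedSpace ℝ X] (v : Ordinal.{0}) :
    Set (ℕ × X) :=
  {p | ‖p.2‖ ≤ p.1 + 1 ∧ ∀ β, ∀ _ : β < v, p ∈ closure (sprawlStep (sprawlSet X β))}
termination_by v

lemma mem_sprawlSet {v : Ordinal.{0}} {p : ℕ × X} : p ∈ sprawlSet X v ↔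
    ‖p.2‖ ≤ p.1 + 1 ∧ ∀ β < v, p ∈ closure (sprawlStep (sprawlSet X β)) := by
  rw [sprawlSet]; rfl

/-- The derivation stabilizes at a countable ordinal when `X` is separable. -/
lemma exists_countable_sprawlSet_subset [TopologicalSpace.SeparableSpace X] :
    ∃ v : Ordinal.{0}, (Set.Iio v).Countable ∧
      sprawlSet X v ⊆ closure (sprawlStep (sprawlSet X v)) := by
  have : SecondCountableTopology X := UniformSpace.secondCountable_of_separable X
  let 𝓑 := TopologicalSpace.countableBasis (ℕ × X)
  have hsep : ∀ v : Ordinal.{0}, ¬ sprawlSet X v ⊆ closure (sprawlStep (sprawlSet X v)) →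
      ∃ U ∈ 𝓑, ∃ p ∈ sprawlSet X v, p ∈ U ∧ Disjoint U (closure (sprawlStep (sprawlSet X v))) := by
    intro v hv
    obtain ⟨p, hp, hpc⟩ := Set.not_subset.1 hv
    obtain ⟨U, hU, hpU, hUc⟩ :=
      (TopologicalSpace.isBasis_countableBasis (ℕ × X)).exists_subset_of_mem_open
        (show p ∈ (closure (sprawlStep (sprawlSet X v)))ᶜ from hpc) isClosed_closure.isOpen_compl
    exact ⟨U, hU, p, hp, hpU, Set.subset_compl_iff_disjoint_right.1 hUc⟩
  choose! U hU p hp hpU hdisj using hsep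
  have hinj : Set.InjOn U {v | ¬ sprawlSet X v ⊆ closure (sprawlStep (sprawlSet X v))} := by
    have key : ∀ v w, v < w → ¬ sprawlSet X v ⊆ closure (sprawlStep (sprawlSet X v)) →
        ¬ sprawlSet X w ⊆ closure (sprawlStep (sprawlSet X w)) → U v ≠ U w := by
      intro v w hvw hv hw he
      exact Set.disjoint_left.1 (hdisj v hv) (he ▸ hpU w hw) ((mem_sprawlSet.1 (hp w hw)).2 v hvw)
    intro v hv w hw he
    rcases lt_trichotomy v w with h | h | h
    exacts [(key v w h hv hw he).elim, h, (key w v h hw hv he.symm).elim]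
  have hcount : {v | ¬ sprawlSet X v ⊆ closure (sprawlStep (sprawlSet X v))}.Countable :=
    Set.MapsTo.countable_of_injOn (fun v hv => hU v hv) hinj
      (TopologicalSpace.countable_countableBasis _)
  have hex : ∃ v : Ordinal.{0}, sprawlSet X v ⊆ closure (sprawlStep (sprawlSet X v)) := by
    by_contra! h
    have : (Set.univ : Set Ordinal.{0}).Countable := hcount.mono fun v _ => h v
    have : Countable Ordinal.{0} := Set.countable_univ_iff.1 this
    exact not_small_ordinal.{0} inferInstance
  refine ⟨sInf {v | sprawlSet X v ⊆ closure (sprawlStep (sprawlSet X v))}, ?_, csInf_mem hex⟩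
  refine hcount.mono fun w hw => ?_
  exact notMem_of_lt_csInf' (s := {v | sprawlSet X v ⊆ closure (sprawlStep (sprawlSet X v))}) hw

/-- The ordinal attached to a finite sequence by the ranks `g`, starting from `v`. -/
def pathRank (v : Ordinal.{0}) (g : ℕ → Ordinal.{0}) : List (Bool × ℕ) → Ordinal.{0}
  | [] => v
  | p :: _ => g p.2

/-- The finite sequences along which the ranks `g` strictly decrease from `v`. -/
def decreasingPaths (v : Ordinal.{0}) (g : ℕ → Ordinal.{0}) : Set (List (Bool × ℕ)) :=
  {σ | List.rec True (fun p σ ih => ih ∧ g p.2 < pathRank v g σ) σ}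

lemma nil_mem_decreasingPaths (v : Ordinal.{0}) (g : ℕ → Ordinal.{0}) :
    [] ∈ decreasingPaths v g := trivial

lemma cons_mem_decreasingPaths {v : Ordinal.{0}} {g : ℕ → Ordinal.{0}} {p : Bool × ℕ}
    {σ : List (Bool × ℕ)} : p :: σ ∈ decreasingPaths v g ↔
      σ ∈ decreasingPaths v g ∧ g p.2 < pathRank v g σ := Iff.rfl

lemma mem_decreasingPaths_of_suffix {v : Ordinal.{0}} {g : ℕ → Ordinal.{0}}
    {σ τ : List (Bool × ℕ)} (h : σ <:+ τ) (hτ : τ ∈ decreasingPaths v g) :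
    σ ∈ decreasingPaths v g := by
  obtain ⟨l, rfl⟩ := h
  induction l with
  | nil => exact hτ
  | cons p l ih => exact ih (cons_mem_decreasingPaths.1 hτ).1

lemma isClosed_diamondSet_decreasingPaths (v : Ordinal.{0}) (g : ℕ → Ordinal.{0})
    {σ : List (Bool × ℕ)} (hσ : σ ∈ decreasingPaths v g) :
    IsClosed (diamondSet (decreasingPaths v g) σ) := by
  induction hr : pathRank v g σ using WellFoundedLT.induction generalizing σ with
  | ind r ih =>
    subst hr
    refine isClosed_diamondSet_of_children hσ fun b n => ?_
    by_cases hn : (b, n) :: σ ∈ decreasingPaths v g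
    · exact ih _ (cons_mem_decreasingPaths.1 hn).2 hn rfl
    · convert isClosed_empty
      refine Set.eq_empty_of_forall_notMem fun q ⟨τ, hτ, hs, _⟩ => hn ?_
      exact mem_decreasingPaths_of_suffix hs hτ

lemma diamondPoles_mem_diamondSet {T : Set (List (Bool × ℕ))} {σ : List (Bool × ℕ)}
    (h : σ ∈ T) : (diamondPoles σ).1 ∈ diamondSet T [] ∧ (diamondPoles σ).2 ∈ diamondSet T [] :=
  ⟨⟨σ, h, List.nil_suffix, .inl rfl⟩, ⟨σ, h, List.nil_suffix, .inr rfl⟩⟩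

lemma sprawlSet_nonempty_of_embedding
    (h : ∀ (M : Type) (_ : MetricSpace M), Countable M → CompleteSpace M →
      ∃ (f : M → X) (A B : ℝ), 0 < A ∧ A ≤ B ∧
        ∀ u v : M, A * dist u v ≤ ‖f u - f v‖ ∧ ‖f u - f v‖ ≤ B * dist u v)
    {v : Ordinal.{0}} (hv : (Set.Iio v).Countable) : (sprawlSet X v).Nonempty := by
  obtain ⟨g₀, hg₀⟩ := Set.countable_iff_exists_subset_range.1 hv
  let g : ℕ → Ordinal.{0} := fun n => g₀ n.unpair.1
  let T := decreasingPaths v g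
  obtain ⟨f₀, A, B, hA, hAB, hf₀⟩ := h (diamondSet T []) inferInstance
    (countable_diamondSet T []).to_subtype
    (isClosed_diamondSet_decreasingPaths v g (nil_mem_decreasingPaths v g)).completeSpace_coe
  classical
  let f : C₀(ℕ, ℝ) → X := fun q => if hq : q ∈ diamondSet T [] then f₀ ⟨q, hq⟩ else 0
  have hf : ∀ p ∈ diamondSet T [], ∀ q ∈ diamondSet T [],
      A * ‖p - q‖ ≤ ‖f p - f q‖ ∧ ‖f p - f q‖ ≤ B * ‖p - q‖ := by
    intro p hp q hq
    simpa [f, hp, hq, Subtype.dist_eq, dist_eq_norm] using hf₀ ⟨p, hp⟩ ⟨q, hq⟩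
  obtain ⟨k, hk⟩ := exists_nat_ge (max A⁻¹ B)
  have hkA : ((k : ℝ) + 1)⁻¹ ≤ A := by
    rw [inv_le_comm₀ (by positivity) hA]
    linarith [le_max_left A⁻¹ B]
  suffices ∀ σ ∈ T, (k, diamondQuot f σ) ∈ sprawlSet X (pathRank v g σ) from
    ⟨_, this [] (nil_mem_decreasingPaths v g)⟩
  intro σ hσ
  induction hr : pathRank v g σ using WellFoundedLT.induction generalizing σ with
  | ind r ih =>
    subst hr
    refine mem_sprawlSet.2 ⟨?_, fun β hβ => subset_closure ?_⟩
    · have := norm_diamondQuot_le (hA.le.trans hAB)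
        (hf _ (diamondPoles_mem_diamondSet hσ).2 _ (diamondPoles_mem_diamondSet hσ).1).2
      dsimp only
      linarith [le_max_right A⁻¹ B]
    · have hrank : ∀ {τ : List (Bool × ℕ)}, τ ∈ T → pathRank v g τ ≤ v := by
        intro τ hτ
        induction τ with
        | nil => exact le_rfl
        | cons p τ ihτ => exact (cons_mem_decreasingPaths.1 hτ).2.le.trans (ihτ hτ.1)
      obtain ⟨a, rfl⟩ := hg₀ (show β ∈ Set.Iio v from hβ.trans_le (hrank hσ))
      have hg : ∀ j, g (Nat.pair a j) = g₀ a := fun j => by simp [g]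
      have hmem : ∀ b j, (b, Nat.pair a j) :: σ ∈ T := fun b j =>
        cons_mem_decreasingPaths.2 ⟨hσ, (hg j).trans_lt hβ⟩
      refine ⟨fun j => diamondQuot f ((false, Nat.pair a j) :: σ),
        fun j => diamondQuot f ((true, Nat.pair a j) :: σ),
        fun j => ih _ hβ _ (hmem _ _) (hg j), fun j => ih _ hβ _ (hmem _ _) (hg j),
        fun j => diamondQuot_eq_half f σ _, fun i j hij => hkA.trans ?_⟩
      exact le_norm_diamondQuot_sub hA.le (fun he => hij (Nat.pair_eq_pair.1 he).2)
        (hf _ (diamondPoles_mem_diamondSet (hmem false i)).2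
          _ (diamondPoles_mem_diamondSet (hmem false j)).2).1

lemma infiniteSprawlingTreeProperty_of_countable_embeddings [TopologicalSpace.SeparableSpace X]
    (h : ∀ (M : Type) (_ : MetricSpace M), Countable M → CompleteSpace M →
      ∃ (f : M → X) (A B : ℝ), 0 < A ∧ A ≤ B ∧
        ∀ u v : M, A * dist u v ≤ ‖f u - f v‖ ∧ ‖f u - f v‖ ≤ B * dist u v) :
    InfiniteSprawlingTreeProperty X := by
  obtain ⟨v, hv, hstable⟩ := exists_countable_sprawlSet_subset (X := X)
  obtain ⟨⟨k, u₀⟩, hu₀⟩ := sprawlSet_nonempty_of_embedding h hv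
  refine infiniteSprawlingTreeProperty_of_approx (δ := ((k : ℝ) + 1)⁻¹) (R := k + 1)
    (by positivity) (C := {u | (k, u) ∈ sprawlSet X v}) ⟨u₀, hu₀⟩
    (fun u hu => (mem_sprawlSet.1 hu).1) ?_
  intro u hu ε hε
  obtain ⟨⟨j, w⟩, hw, hjw⟩ := Metric.mem_closure_iff.1 (hstable hu) (min ε 1) (by positivity)
  rw [Prod.dist_eq, max_lt_iff] at hjw
  have hj : k = j := by
    by_contra hne
    exact (hjw.1.trans_le (min_le_right _ _)).not_ge (Nat.pairwise_one_le_dist hne)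
  subst hj
  exact ⟨w, by rw [← dist_eq_norm]; exact hjw.2.trans_le (min_le_left _ _), hw⟩

/-- If every countable complete metric space bi-Lipschitz embeds into the
separable Banach space `X`, then `X` has the Infinite Sprawling Tree Property and fails the
Slice PCP; and if `c₀` bi-Lipschitz embeds into `X`, then `X` fails the Slice PCP. -/
theorem statement18 {X : Type*} [NormedAddCommGroup X] [NormedSpace ℝ X] [CompleteSpace X]
    [TopologicalSpace.SeparableSpace X] :
    ((∀ (M : Type) (_ : MetricSpace M), Countable M → CompleteSpace M →
        ∃ (f : M → X) (A B : ℝ), 0 < A ∧ A ≤ B ∧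
          ∀ u v : M, A * dist u v ≤ ‖f u - f v‖ ∧ ‖f u - f v‖ ≤ B * dist u v) →
      InfiniteSprawlingTreeProperty X ∧ ¬ SlicePCP X) ∧
    ((∃ (f : ZeroAtInftyContinuousMap ℕ ℝ → X) (A B : ℝ), 0 < A ∧ A ≤ B ∧
        ∀ u v : ZeroAtInftyContinuousMap ℕ ℝ,
          A * ‖u - v‖ ≤ ‖f u - f v‖ ∧ ‖f u - f v‖ ≤ B * ‖u - v‖) →
      ¬ SlicePCP X) := by
  refine ⟨fun h => ?_, fun ⟨f, A, B, hA, hAB, hf⟩ =>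
    (infiniteSprawlingTreeProperty_of_c0_embedding hA hAB hf).not_slicePCP⟩
  have hI := infiniteSprawlingTreeProperty_of_countable_embeddings h
  exact ⟨hI, hI.not_slicePCP⟩
end
end

section
/- Let X be a Banach space and assume that L₁[0,1] (the space of equivalence classes of Lebesgue-integrable real functions on [0,1] with the L¹ norm) bi-Lipschitz embeds into X. Then X fails the Slice Point of Continuity Property. -/
open Metric Set Topology

noncomputable section

variable {X : Type*} [NormedAddCommGroup X] [NormedSpace ℝ X]

attribute [local instance] MeasureTheory.Measure.Subtype.measureSpace

section OscillatingMultipliers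

open MeasureTheory Filter

/-- **Riemann–Lebesgue lemma** on the unit interval, along integer cosine frequencies. -/
theorem tendsto_integral_mul_cos_unitInterval {g : Set.Icc (0 : ℝ) 1 → ℝ} (hg : Integrable g) :
    Tendsto (fun n : ℕ => ∫ x, g x * Real.cos (2 * Real.pi * n * (x : ℝ))) atTop (𝓝 0) := by
  let G : ℝ → ℂ := (Set.Icc (0 : ℝ) 1).indicator
    fun t => (g (Set.projIcc 0 1 zero_le_one t) : ℂ)
  have hcast : Tendsto (fun n : ℕ => (n : ℝ)) atTop (cocompact ℝ) :=
    tendsto_natCast_atTop_atTop.mono_right atTop_le_cocompact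
  have key := (Real.tendsto_integral_exp_smul_cocompact G).comp hcast
  have hre := (Complex.continuous_re.tendsto 0).comp key
  rw [Complex.zero_re] at hre
  refine hre.congr fun n => ?_
  have h1 : ∫ t : ℝ, Real.fourierChar (-(t * (n : ℝ))) • G t
      = ∫ x : Set.Icc (0 : ℝ) 1, Real.fourierChar (-((x : ℝ) * (n : ℝ))) • (g x : ℂ) := by
    have h2 : (fun t : ℝ => Real.fourierChar (-(t * (n : ℝ))) • G t)
        = (Set.Icc (0 : ℝ) 1).indicator fun t =>
          Real.fourierChar (-(t * (n : ℝ))) • (g (Set.projIcc 0 1 zero_le_one t) : ℂ) := by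
      ext t
      by_cases ht : t ∈ Set.Icc (0 : ℝ) 1 <;> simp [G, ht]
    rw [h2, integral_indicator measurableSet_Icc, ← integral_subtype_comap measurableSet_Icc]
    refine integral_congr_ae (Eventually.of_forall fun x => ?_)
    simp
  have hint : Integrable
      (fun x : Set.Icc (0 : ℝ) 1 => Real.fourierChar (-((x : ℝ) * (n : ℝ))) • (g x : ℂ)) := by
    have hgc : Integrable (fun x => (g x : ℂ)) := hg.ofReal
    refine hgc.mono ?_ (Eventually.of_forall fun x => by simp)
    refine Continuous.aestronglyMeasurable ?_ |>.smul hgc.aestronglyMeasurable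
    fun_prop
  simp only [Function.comp_apply]
  rw [h1, ← RCLike.re_eq_complex_re, ← integral_re hint]
  refine integral_congr_ae (Eventually.of_forall fun x => ?_)
  have harg : (2 * Real.pi * -((x : ℝ) * n)) = -(2 * Real.pi * n * (x : ℝ)) := by ring
  simp only [Circle.smul_def, Real.fourierChar_apply, harg, RCLike.re_eq_complex_re, smul_eq_mul,
    Complex.re_mul_ofReal, Complex.exp_ofReal_mul_I_re, Real.cos_neg]
  ring

/-- Every `L¹` function on the unit interval has a uniformly separated sequence of
approximate metric midpoints between itself and `0`. -/
theorem exists_separated_approx_midpoints_zero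
    (z : Lp ℝ 1 (volume : Measure (Set.Icc (0 : ℝ) 1))) (hz : z ≠ 0) :
    ∃ k : ℕ → Lp ℝ 1 (volume : Measure (Set.Icc (0 : ℝ) 1)),
      Tendsto (fun n => ‖k n‖) atTop (𝓝 (‖z‖ / 2)) ∧
      Tendsto (fun n => ‖z - k n‖) atTop (𝓝 (‖z‖ / 2)) ∧
      ∀ m, ∀ᶠ n in atTop, ‖z‖ / 16 ≤ ‖k n - k m‖ := by
  have hzi : Integrable (fun x => z x) := L1.integrable_coeFn z
  have hgi : Integrable (fun x => |z x|) := hzi.abs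
  have hnorm : ‖z‖ = ∫ x, |z x| := by simpa using L1.norm_eq_integral_norm z
  let c : ℕ → Set.Icc (0 : ℝ) 1 → ℝ := fun n x => Real.cos (2 * Real.pi * n * (x : ℝ))
  have hc : ∀ n x, |c n x| ≤ 1 := fun n x => Real.abs_cos_le_one _
  have hcm : ∀ n, Continuous (c n) := fun n => by fun_prop
  have hmul : ∀ {h : Set.Icc (0 : ℝ) 1 → ℝ} (n : ℕ), Integrable h →
      Integrable (fun x => h x * c n x) := fun n hh =>
    hh.mul_bdd (c := 1) (hcm n).aestronglyMeasurable (Eventually.of_forall (hc n))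
  have hRL : ∀ {h : Set.Icc (0 : ℝ) 1 → ℝ}, Integrable h →
      Tendsto (fun n => ∫ x, h x * c n x) atTop (𝓝 0) :=
    fun hh => tendsto_integral_mul_cos_unitInterval hh
  have hki : ∀ n, Integrable (fun x => 2⁻¹ * (z x + z x * c n x)) := fun n =>
    (hzi.add (hmul n hzi)).const_mul _
  let k : ℕ → Lp ℝ 1 (volume : Measure (Set.Icc (0 : ℝ) 1)) := fun n => (hki n).toL1 _
  have hk : ∀ n, k n =ᵐ[volume] fun x => 2⁻¹ * (z x + z x * c n x) := fun n =>
    (hki n).coeFn_toL1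
  have hk1 : ∀ n, ‖k n‖ = 2⁻¹ * ((∫ x, |z x|) + ∫ x, |z x| * c n x) := by
    intro n
    rw [L1.norm_eq_integral_norm, ← integral_add hgi (hmul n hgi), ← integral_const_mul]
    refine integral_congr_ae ?_
    filter_upwards [hk n] with x hx
    have := abs_le.1 (hc n x)
    rw [hx, Real.norm_eq_abs, show 2⁻¹ * (z x + z x * c n x) = 2⁻¹ * (1 + c n x) * z x by ring,
      abs_mul, abs_of_nonneg (by linarith : (0 : ℝ) ≤ 2⁻¹ * (1 + c n x))]
    ring
  have hk2 : ∀ n, ‖z - k n‖ = 2⁻¹ * ((∫ x, |z x|) - ∫ x, |z x| * c n x) := by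
    intro n
    rw [L1.norm_eq_integral_norm, ← integral_sub hgi (hmul n hgi), ← integral_const_mul]
    refine integral_congr_ae ?_
    filter_upwards [hk n, Lp.coeFn_sub z (k n)] with x hx hx'
    have := abs_le.1 (hc n x)
    rw [hx', Pi.sub_apply, hx, Real.norm_eq_abs,
      show z x - 2⁻¹ * (z x + z x * c n x) = 2⁻¹ * (1 - c n x) * z x by ring,
      abs_mul, abs_of_nonneg (by linarith : (0 : ℝ) ≤ 2⁻¹ * (1 - c n x))]
    ring
  have hcc : ∀ n x, c n x * c n x = 2⁻¹ * (1 + c (2 * n) x) := by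
    intro n x
    have := Real.cos_sq (2 * Real.pi * n * (x : ℝ))
    simp only [c]
    rw [← sq, this]
    push_cast
    ring_nf
  have hk3 : ∀ m n, 4⁻¹ * (2⁻¹ * ((∫ x, |z x|) + ∫ x, |z x| * c (2 * n) x)
      - 2 * ∫ x, |z x| * c m x * c n x) ≤ ‖k n - k m‖ := by
    intro m n
    rw [L1.norm_eq_integral_norm, ← integral_add hgi (hmul _ hgi), ← integral_const_mul,
      ← integral_const_mul, ← integral_sub, ← integral_const_mul]
    · refine integral_mono_ae ?_ (L1.integrable_coeFn _).norm ?_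
      · exact (((hgi.add (hmul _ hgi)).const_mul _).sub
          ((hmul n (hmul m hgi)).const_mul _)).const_mul _
      filter_upwards [hk n, hk m, Lp.coeFn_sub (k n) (k m)] with x hn hm hx
      rw [hx, Pi.sub_apply, hn, hm, Real.norm_eq_abs,
        show 2⁻¹ * (z x + z x * c n x) - 2⁻¹ * (z x + z x * c m x)
          = z x * (2⁻¹ * (c n x - c m x)) by ring, abs_mul,
        show 4⁻¹ * (2⁻¹ * (|z x| + |z x| * c (2 * n) x) - 2 * (|z x| * c m x * c n x))
          = |z x| * (4⁻¹ * (2⁻¹ * (1 + c (2 * n) x) - 2 * c m x * c n x)) by ring, ← hcc]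
      refine mul_le_mul_of_nonneg_left ?_ (abs_nonneg _)
      have h2 : |c n x - c m x| ≤ 2 := by
        linarith [abs_sub (c n x) (c m x), hc n x, hc m x]
      rw [abs_mul, abs_of_pos (by norm_num : (0 : ℝ) < 2⁻¹)]
      nlinarith [sq_abs (c n x - c m x), abs_nonneg (c n x - c m x), mul_self_nonneg (c m x)]
    · exact (hgi.add (hmul _ hgi)).const_mul _
    · exact (hmul n (hmul m hgi)).const_mul _
  refine ⟨k, ?_, ?_, fun m => ?_⟩
  · simp_rw [hk1]
    convert! ((hRL hgi).const_add (∫ x, |z x|)).const_mul 2⁻¹ using 2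
    rw [hnorm]; ring
  · simp_rw [hk2]
    convert! ((hRL hgi).const_sub (∫ x, |z x|)).const_mul 2⁻¹ using 2
    rw [hnorm]; ring
  · have hdouble : Tendsto (fun n : ℕ => 2 * n) atTop atTop :=
      tendsto_id.const_mul_atTop' two_pos
    have hlim := (((((hRL hgi).comp hdouble).const_add (∫ x, |z x|)).const_mul 2⁻¹).sub
      ((hRL (hmul m hgi)).const_mul 2)).const_mul 4⁻¹
    have hlt : ‖z‖ / 16 < 4⁻¹ * (2⁻¹ * ((∫ x, |z x|) + 0) - 2 * 0) := by
      have := norm_pos_iff.2 hz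
      rw [← hnorm]; linarith
    filter_upwards [hlim.eventually_const_lt hlt] with n hn
    exact hn.le.trans (hk3 m n)

end OscillatingMultipliers

section WeakOscillation

open Filter

theorem tendsto_nhds_weakTop_iff {X ι : Type*} [NormedAddCommGroup X] [NormedSpace ℝ X]
    {l : Filter ι} {y : ι → X} {x : X} :
    Tendsto y l (@nhds X (weakTop X) x) ↔
      ∀ φ : X →L[ℝ] ℝ, Tendsto (fun i => φ (y i)) l (𝓝 (φ x)) := by
  rw [weakTop, nhds_induced, tendsto_comap_iff, tendsto_pi_nhds]
  rfl

/-- Differences of a bounded sequence tend weakly to zero along the square of an ultrafilter. -/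
theorem tendsto_sub_prod_ultrafilter {X ι : Type*} [NormedAddCommGroup X] [NormedSpace ℝ X]
    (U : Ultrafilter ι) {y : ι → X} {R : ℝ} (hy : ∀ᶠ i in U, ‖y i‖ ≤ R) (φ : X →L[ℝ] ℝ) :
    Tendsto (fun p : ι × ι => φ (y p.1 - y p.2)) ((U : Filter ι) ×ˢ U) (𝓝 0) := by
  have hmem : ∀ᶠ i in U, φ (y i) ∈ Metric.closedBall (0 : ℝ) (‖φ‖ * R) := by
    filter_upwards [hy] with i hi
    rw [mem_closedBall_zero_iff]
    exact (φ.le_opNorm _).trans (mul_le_mul_of_nonneg_left hi (norm_nonneg _))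
  obtain ⟨t, -, ht⟩ := (isCompact_closedBall (0 : ℝ) (‖φ‖ * R)).ultrafilter_le_nhds
    (U.map fun i => φ (y i)) (le_principal_iff.2 hmem)
  have ht' : Tendsto (fun i => φ (y i)) U (𝓝 t) := ht
  simpa using (ht'.comp tendsto_fst).sub (ht'.comp tendsto_snd)

end WeakOscillation

/-- The difference quotients of a map between normed spaces. -/
def differenceQuotients {E X : Type*} [NormedAddCommGroup E] [NormedAddCommGroup X]
    [NormedSpace ℝ X] (f : E → X) : Set X :=
  {x | ∃ u v : E, u ≠ v ∧ x = ‖u - v‖⁻¹ • (f u - f v)}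

/-- The averages of two difference quotients of a map between normed spaces. -/
def averagedQuotients {E X : Type*} [NormedAddCommGroup E] [NormedAddCommGroup X]
    [NormedSpace ℝ X] (f : E → X) : Set X :=
  {x | ∃ s ∈ differenceQuotients f, ∃ t ∈ differenceQuotients f, x = (2⁻¹ : ℝ) • (s + t)}

theorem differenceQuotients_subset_averagedQuotients {E X : Type*} [NormedAddCommGroup E]
    [NormedAddCommGroup X] [NormedSpace ℝ X] (f : E → X) :
    differenceQuotients f ⊆ averagedQuotients f := fun x hx =>
  ⟨x, hx, x, hx, by rw [← two_smul ℝ x, smul_smul]; norm_num⟩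

theorem norm_le_of_mem_averagedQuotients {E X : Type*} [NormedAddCommGroup E]
    [NormedAddCommGroup X] [NormedSpace ℝ X] {f : E → X} {B : ℝ}
    (hf : ∀ u v, ‖f u - f v‖ ≤ B * ‖u - v‖) {x : X} (hx : x ∈ averagedQuotients f) : ‖x‖ ≤ B := by
  have hq : ∀ s ∈ differenceQuotients f, ‖s‖ ≤ B := by
    rintro _ ⟨u, v, huv, rfl⟩
    have hpos : 0 < ‖u - v‖ := norm_pos_iff.2 (sub_ne_zero.2 huv)
    rw [norm_smul, norm_inv, norm_norm, inv_mul_le_iff₀ hpos, mul_comm]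
    exact hf u v
  obtain ⟨s, hs, t, ht, rfl⟩ := hx
  rw [norm_smul, Real.norm_of_nonneg (by norm_num)]
  linarith [norm_add_le s t, hq s hs, hq t ht]

/-- If the domain has separated approximate midpoints of `u` and `v`, then the difference quotient
of a bi-Lipschitz map at `u`, `v` is not a point of small weak oscillation of the set of averaged
difference quotients. -/
theorem le_diam_inter_averagedQuotients {E X : Type*} [NormedAddCommGroup E]
    [NormedAddCommGroup X] [NormedSpace ℝ X] {f : E → X} {A B : ℝ} (hA : 0 < A)
    (hlow : ∀ u v, A * ‖u - v‖ ≤ ‖f u - f v‖) (hup : ∀ u v, ‖f u - f v‖ ≤ B * ‖u - v‖)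
    {u v : E} (huv : u ≠ v) {w : ℕ → E}
    (hwv : Filter.Tendsto (fun n => ‖w n - v‖) Filter.atTop (𝓝 (‖u - v‖ / 2)))
    (huw : Filter.Tendsto (fun n => ‖u - w n‖) Filter.atTop (𝓝 (‖u - v‖ / 2)))
    (hsep : ∀ m, ∀ᶠ n in Filter.atTop, ‖u - v‖ / 16 ≤ ‖w n - w m‖)
    {V : Set X} (hV : V ∈ @nhds X (weakTop X) (‖u - v‖⁻¹ • (f u - f v))) :
    A / 32 ≤ Metric.diam (V ∩ averagedQuotients f) := by
  set d : ℝ := ‖u - v‖ with hd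
  have hdpos : 0 < d := norm_pos_iff.2 (sub_ne_zero.2 huv)
  set x : X := d⁻¹ • (f u - f v) with hx
  let U : Ultrafilter ℕ := Filter.hyperfilter ℕ
  have hU : (U : Filter ℕ) ≤ Filter.atTop := Nat.hyperfilter_le_atTop
  let e : ℕ → X := fun n => ((2 * ‖w n - v‖)⁻¹ - d⁻¹) • (f (w n) - f v)
  let e' : ℕ → X := fun n => ((2 * ‖u - w n‖)⁻¹ - d⁻¹) • (f u - f (w n))
  have hlim : ∀ {r : ℕ → ℝ} {y : ℕ → X}, Filter.Tendsto r Filter.atTop (𝓝 (d / 2)) →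
      (∀ n, ‖y n‖ ≤ B * r n) →
      Filter.Tendsto (fun n => ((2 * r n)⁻¹ - d⁻¹) • y n) Filter.atTop (𝓝 0) := by
    intro r y hr hy
    have h2 : 2 * (d / 2) = d := by ring
    have hcoef := (((hr.const_mul 2).inv₀ (by rw [h2]; exact hdpos.ne')).sub_const d⁻¹).norm
    have := hcoef.mul (hr.const_mul B)
    rw [h2, sub_self, norm_zero, zero_mul] at this
    refine squeeze_zero_norm (fun n => ?_) this
    rw [norm_smul]
    exact mul_le_mul_of_nonneg_left (hy n) (norm_nonneg _)
  have he : Filter.Tendsto e U (𝓝 0) := (hlim hwv fun n => hup _ _).mono_left hU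
  have he' : Filter.Tendsto e' U (𝓝 0) := (hlim huw fun n => hup _ _).mono_left hU
  let y : ℕ × ℕ → X := fun p => x + d⁻¹ • (f (w p.1) - f (w p.2)) + (e p.1 + e' p.2)
  have herr : Filter.Tendsto (fun p : ℕ × ℕ => e p.1 + e' p.2) ((U : Filter ℕ) ×ˢ U) (𝓝 0) := by
    simpa using (he.comp Filter.tendsto_fst).add (he'.comp Filter.tendsto_snd)
  have hbdd : ∀ᶠ n in U, ‖f (w n) - f v‖ ≤ B * d := by
    have hev : ∀ᶠ n in Filter.atTop, ‖w n - v‖ < d := hwv.eventually_lt_const (by linarith)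
    filter_upwards [hU hev] with n hn
    have hB : 0 < B := by
      have := (hlow u v).trans (hup u v)
      exact hA.trans_le (le_of_mul_le_mul_right this hdpos)
    exact (hup _ _).trans (mul_le_mul_of_nonneg_left (le_of_lt hn) hB.le)
  have hyweak : Filter.Tendsto y ((U : Filter ℕ) ×ˢ U) (@nhds X (weakTop X) x) := by
    rw [tendsto_nhds_weakTop_iff]
    intro φ
    have h1 := (tendsto_sub_prod_ultrafilter U hbdd φ).const_mul d⁻¹
    have h2 := (φ.continuous.tendsto 0).comp herr
    have h3 := (h1.const_add (φ x)).add h2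
    simp only [map_zero, mul_zero, add_zero, sub_sub_sub_cancel_right] at h3
    refine h3.congr fun p => ?_
    simp [y]
  have hymem : ∀ᶠ p in (U : Filter ℕ) ×ˢ U, y p ∈ averagedQuotients f := by
    have h1 : ∀ᶠ n in U, 0 < ‖w n - v‖ := hU (hwv.eventually_const_lt (by linarith))
    have h2 : ∀ᶠ n in U, 0 < ‖u - w n‖ := hU (huw.eventually_const_lt (by linarith))
    filter_upwards [h1.prod_mk h2] with p hp
    refine ⟨_, ⟨w p.1, v, sub_ne_zero.1 (norm_pos_iff.1 hp.1), rfl⟩,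
      _, ⟨u, w p.2, sub_ne_zero.1 (norm_pos_iff.1 hp.2), rfl⟩, ?_⟩
    simp only [y, e, e', hx, mul_inv]
    module
  have hsmall : ∀ᶠ p : ℕ × ℕ in (U : Filter ℕ) ×ˢ U, ‖e p.1 + e' p.2‖ < A / 32 := by
    have := herr.norm
    rw [norm_zero] at this
    exact this.eventually_lt_const (by positivity)
  have hfreq : ∃ᶠ p : ℕ × ℕ in (U : Filter ℕ) ×ˢ U, d / 16 ≤ ‖w p.1 - w p.2‖ := by
    intro hnot
    obtain ⟨P, hP, Q, hQ, hPQ⟩ := Filter.eventually_prod_iff.1 hnot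
    obtain ⟨m, hm⟩ := hQ.exists
    obtain ⟨n, hn, hnm⟩ := (hP.and (hU (hsep m))).exists
    exact hPQ hn hm hnm
  obtain ⟨p, hp, hpV, hpmem, hps⟩ :=
    (hfreq.and_eventually ((hyweak.eventually (Filter.eventually_mem_set.2 hV)).and (hymem.and hsmall))).exists
  have hxV : x ∈ V := @mem_of_mem_nhds X (weakTop X) x V hV
  have hxmem : x ∈ averagedQuotients f :=
    differenceQuotients_subset_averagedQuotients f ⟨u, v, huv, rfl⟩
  have hbound : Bornology.IsBounded (V ∩ averagedQuotients f) :=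
    (isBounded_iff_forall_norm_le.2
      ⟨B, fun _ h => norm_le_of_mem_averagedQuotients hup h⟩).subset inter_subset_right
  refine le_trans ?_ (Metric.dist_le_diam_of_mem hbound ⟨hpV, hpmem⟩ ⟨hxV, hxmem⟩)
  have hmain : A / 16 ≤ ‖d⁻¹ • (f (w p.1) - f (w p.2))‖ := by
    rw [norm_smul, norm_inv, Real.norm_of_nonneg hdpos.le, ← div_eq_inv_mul, le_div_iff₀ hdpos]
    calc A / 16 * d = A * (d / 16) := by ring
      _ ≤ A * ‖w p.1 - w p.2‖ := mul_le_mul_of_nonneg_left hp hA.le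
      _ ≤ _ := hlow _ _
  have hdist : dist (y p) x = ‖d⁻¹ • (f (w p.1) - f (w p.2)) + (e p.1 + e' p.2)‖ := by
    rw [dist_eq_norm]
    congr 1
    simp only [y]
    abel
  rw [hdist]
  linarith [norm_sub_le_norm_add (d⁻¹ • (f (w p.1) - f (w p.2))) (e p.1 + e' p.2)]

/-- If `L₁[0,1]` bi-Lipschitz embeds into the Banach space `X`, then `X`
fails the Slice Point of Continuity Property. -/
theorem statement19 {X : Type*} [NormedAddCommGroup X] [NormedSpace ℝ X] [CompleteSpace X]
    (hemb : ∃ (f : MeasureTheory.Lp ℝ 1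
          (MeasureTheory.volume : MeasureTheory.Measure (Set.Icc (0 : ℝ) 1)) → X)
        (A B : ℝ), 0 < A ∧ A ≤ B ∧
        ∀ u v : MeasureTheory.Lp ℝ 1
          (MeasureTheory.volume : MeasureTheory.Measure (Set.Icc (0 : ℝ) 1)),
          A * ‖u - v‖ ≤ ‖f u - f v‖ ∧ ‖f u - f v‖ ≤ B * ‖u - v‖) :
    ¬ SlicePCP X := by
  obtain ⟨f, A, B, hA, -, hf⟩ := hemb
  intro hPCP
  obtain ⟨k₀⟩ : Nonempty (Nontrivial (MeasureTheory.Lp ℝ 1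
      (MeasureTheory.volume : MeasureTheory.Measure (Set.Icc (0 : ℝ) 1)))) := by
    refine ⟨⟨MeasureTheory.Lp.const 1 MeasureTheory.volume (1 : ℝ), 0, fun h => ?_⟩⟩
    have hnorm := MeasureTheory.Lp.norm_const' (p := 1) (c := (1 : ℝ))
      (μ := (MeasureTheory.volume : MeasureTheory.Measure (Set.Icc (0 : ℝ) 1)))
      one_ne_zero ENNReal.one_ne_top
    have h0 := hnorm.symm.trans (congrArg norm h)
    simp at h0
  obtain ⟨u₀, v₀, huv₀⟩ := k₀.exists_pair_ne
  obtain ⟨φ, a, ⟨x, hxa, hx⟩, hslice⟩ := hPCP (averagedQuotients f)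
    ⟨_, differenceQuotients_subset_averagedQuotients f ⟨u₀, v₀, huv₀, rfl⟩⟩
    (isBounded_iff_forall_norm_le.2
      ⟨B, fun _ h => norm_le_of_mem_averagedQuotients (fun u v => (hf u v).2) h⟩)
    (A / 32) (by positivity)
  obtain ⟨q, hq, hqa⟩ : ∃ q ∈ differenceQuotients f, a < φ q := by
    obtain ⟨s, hs, t, ht, rfl⟩ := hx
    by_contra! hle
    have h1 := hle s hs
    have h2 := hle t ht
    simp only [mem_ofPred_eq, map_smul, map_add, smul_eq_mul] at hxa
    linarith
  obtain ⟨V, hV, hdiam⟩ := hslice q ⟨hqa, differenceQuotients_subset_averagedQuotients f hq⟩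
  obtain ⟨u, v, huv, rfl⟩ := hq
  obtain ⟨k, hk₁, hk₂, hk₃⟩ := exists_separated_approx_midpoints_zero (u - v) (sub_ne_zero.2 huv)
  refine hdiam.not_ge (le_diam_inter_averagedQuotients hA (fun u v => (hf u v).1)
    (fun u v => (hf u v).2) huv (w := fun n => v + k n) ?_ ?_ ?_ hV)
  · simpa using hk₁
  · simpa [sub_sub] using hk₂
  · simpa using hk₃
end
end
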